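/- For every real λ > 0, every real α ≥ 0, and every pair of independent random variables X and Y each having the Poisson distribution with parameter λ, one has P((X : ℝ) − (Y : ℝ) ≥ α·λ) ≤ exp(λ·(exp(α/2) + exp(−α/2) − 2) − α²·λ/2). -/

import Mathlib

open MeasureTheory

/-- `X` has the Poisson distribution with parameter `lam` under `μ`. -/
def IsPoisson {Ω : Type} [MeasurableSpace Ω] (μ : Measure Ω) (X : Ω → ℕ) (lam : ℝ) : Prop :=
  ∀ k : ℕ, μ {ω | X ω = k} = ENNReal.ofReal (Real.exp (-lam) * lam ^ k / (Nat.factorial k))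

theorem tsum_ofReal_exp_mul_poisson {lam : ℝ} (hlam : 0 ≤ lam) (t : ℝ) :
    ∑' k : ℕ, ENNReal.ofReal
        (Real.exp (t * k) * (Real.exp (-lam) * lam ^ k / (Nat.factorial k)))
      = ENNReal.ofReal (Real.exp (lam * (Real.exp t - 1))) := by
  have hs : HasSum (fun k : ℕ ↦
      Real.exp (t * k) * (Real.exp (-lam) * lam ^ k / (Nat.factorial k)))
      (Real.exp (lam * (Real.exp t - 1))) := by
    have h := (NormedSpace.expSeries_div_hasSum_exp (lam * Real.exp t)).mul_left (Real.exp (-lam))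
    rw [← Real.exp_eq_exp_ℝ, ← Real.exp_add] at h
    rw [show lam * (Real.exp t - 1) = -lam + lam * Real.exp t by ring]
    refine (congrArg (HasSum · _) (funext fun k ↦ ?_)).mpr h
    rw [mul_comm t, Real.exp_nat_mul, mul_pow]
    ring
  rw [← ENNReal.ofReal_tsum_of_nonneg (fun k ↦ by positivity) hs.summable, hs.tsum_eq]

theorem poisson_difference_chernoff (lam : ℝ) (hlam : 0 < lam) (α : ℝ) (hα : 0 ≤ α)
    (Ω : Type) [MeasurableSpace Ω] (μ : Measure Ω) [IsProbabilityMeasure μ]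
    (X Y : Ω → ℕ) (hX : IsPoisson μ X lam) (hY : IsPoisson μ Y lam)
    (hindep : ProbabilityTheory.IndepFun X Y μ) :
    μ {ω | (X ω : ℝ) - (Y ω : ℝ) ≥ α * lam}
      ≤ ENNReal.ofReal
          (Real.exp (lam * (Real.exp (α / 2) + Real.exp (-(α / 2)) - 2) - α ^ 2 * lam / 2)) := by
  set S := {ω | (X ω : ℝ) - (Y ω : ℝ) ≥ α * lam}
  let p : ℝ → ℕ → ℝ := fun t k ↦
    Real.exp (t * k) * (Real.exp (-lam) * lam ^ k / (Nat.factorial k))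
  have hp (t : ℝ) (k : ℕ) : 0 ≤ p t k := by positivity
  have hterm (i j : ℕ) : μ (S ∩ ({ω | X ω = i} ∩ {ω | Y ω = j})) ≤
      ENNReal.ofReal (Real.exp (-(α / 2 * (α * lam)))) *
        (ENNReal.ofReal (p (α / 2) i) * ENNReal.ofReal (p (-(α / 2)) j)) := by
    by_cases hij : α * lam ≤ (i : ℝ) - j
    · refine (measure_mono Set.inter_subset_right).trans ?_
      have h := hindep.measure_inter_preimage_eq_mul {i} {j}
        (measurableSet_singleton i) (measurableSet_singleton j)
      change μ ({ω | X ω = i} ∩ {ω | Y ω = j}) = μ {ω | X ω = i} * μ {ω | Y ω = j} at h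
      rw [h, hX i, hY j, ← ENNReal.ofReal_mul (by positivity), ← ENNReal.ofReal_mul (hp _ _),
        ← ENNReal.ofReal_mul (by positivity)]
      apply ENNReal.ofReal_le_ofReal
      have hexp : 1 ≤ Real.exp (-(α / 2 * (α * lam))) *
          (Real.exp (α / 2 * i) * Real.exp (-(α / 2) * j)) := by
        rw [← Real.exp_add, ← Real.exp_add, Real.one_le_exp_iff]
        nlinarith [mul_nonneg hα (sub_nonneg.mpr hij)]
      refine (le_mul_of_one_le_left (by positivity) hexp).trans_eq ?_
      simp only [p]
      ring
    · have : S ∩ ({ω | X ω = i} ∩ {ω | Y ω = j}) = ∅ := by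
        ext ω
        simp only [Set.mem_inter_iff, Set.mem_ofPred_eq, Set.mem_empty_iff_false, iff_false, S]
        rintro ⟨h, rfl, rfl⟩
        exact hij h
      simp [this]
  calc μ S ≤ μ (⋃ q : ℕ × ℕ, S ∩ ({ω | X ω = q.1} ∩ {ω | Y ω = q.2})) :=
        measure_mono fun ω hω ↦ Set.mem_iUnion.mpr ⟨(X ω, Y ω), hω, rfl, rfl⟩
    _ ≤ ∑' q : ℕ × ℕ, μ (S ∩ ({ω | X ω = q.1} ∩ {ω | Y ω = q.2})) := measure_iUnion_le _
    _ ≤ ∑' q : ℕ × ℕ, ENNReal.ofReal (Real.exp (-(α / 2 * (α * lam)))) *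
        (ENNReal.ofReal (p (α / 2) q.1) * ENNReal.ofReal (p (-(α / 2)) q.2)) :=
        ENNReal.tsum_le_tsum fun q ↦ hterm q.1 q.2
    _ = ENNReal.ofReal (Real.exp (-(α / 2 * (α * lam)))) *
        ((∑' i, ENNReal.ofReal (p (α / 2) i)) * ∑' j, ENNReal.ofReal (p (-(α / 2)) j)) := by
        rw [ENNReal.tsum_mul_left, ENNReal.tsum_prod']
        simp only [ENNReal.tsum_mul_left, ENNReal.tsum_mul_right]
    _ = _ := by
        simp only [p]
        rw [tsum_ofReal_exp_mul_poisson hlam.le, tsum_ofReal_exp_mul_poisson hlam.le,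
          ← ENNReal.ofReal_mul (by positivity), ← ENNReal.ofReal_mul (by positivity),
          ← Real.exp_add, ← Real.exp_add]
        ring_nf
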